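/- arXiv:1903.06331 — 3 statements merged into one kernel-verified Lean document; each statement's English description precedes it below -/
import Mathlib

section
/- Suppose χ > 0 satisfies χ < √(6√3 + 9)/2, and let p₀ := (2√3 − 3)/3. Then for each r ≥ 1 the set S(r) := { p ∈ (0, p₀) : φ₂(p) ≥ φ₁(p)·r } is nonempty; and letting r₀ := 1, p_k := sup S(r_{k-1}) and r_k := φ₁(p_k)·r_{k-1} for k ∈ ℕ recursively defines sequences (p_k) ⊂ (0, p₀] and (r_k) ⊂ (1, ∞) satisfying p_k ≤ p_{k−1} and r_k > r_{k−1} for all k ∈ ℕ, and r_k → ∞ as k → ∞. Moreover, setting q_k := p_k r_k, one has q⁻(p_k) < q_k ≤ q⁺(p_k) for all k ∈ ℕ, where q^±(p) := (1−p)/2 · (1 ± √(1 − pχ²)), as well as q_k ≤ (p_k(p_k+1)/(1−p_k)) · r_{k−1} for all k ∈ ℕ. -/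
open Real MeasureTheory Filter Topology Set
open scoped ENNReal NNReal

noncomputable section

/-- Partial derivative of a space-time function in the first (space) variable. -/
def pdx (f : ℝ → ℝ → ℝ) : ℝ → ℝ → ℝ := fun x t => deriv (fun y => f y t) x

/-- Partial derivative of a space-time function in the second (time) variable. -/
def pdt (f : ℝ → ℝ → ℝ) : ℝ → ℝ → ℝ := fun x t => deriv (fun s => f x s) t

/-- The time interval `[0, Tmax)` (with `Tmax ∈ (0,∞]`). -/
def It (Tmax : ℝ≥0∞) : Set ℝ := {t : ℝ | 0 ≤ t ∧ ENNReal.ofReal t < Tmax}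

/-- The time interval `(0, Tmax)` (with `Tmax ∈ (0,∞]`). -/
def It' (Tmax : ℝ≥0∞) : Set ℝ := {t : ℝ | 0 < t ∧ ENNReal.ofReal t < Tmax}

/-- The waiting time `τ := min{1, Tmax/3}`, as a real number. -/
def tauOf (Tmax : ℝ≥0∞) : ℝ := (min 1 (Tmax / 3)).toReal

/-- Hypothesis (B): `B` is nonnegative, bounded, and locally Hölder continuous on
`Ω̄ × [0,∞)` with some exponent `ϑ ∈ (0,1)`. -/
def HypB (a b : ℝ) (B : ℝ → ℝ → ℝ) : Prop :=
  (∀ x t : ℝ, 0 ≤ B x t) ∧ (∃ M : ℝ, ∀ x t : ℝ, B x t ≤ M) ∧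
  ∃ ϑ : ℝ, ϑ ∈ Set.Ioo (0:ℝ) 1 ∧
    ∀ K : Set (ℝ × ℝ), IsCompact K → K ⊆ (Set.Icc a b) ×ˢ (Set.Ici (0:ℝ)) →
      ∃ C : ℝ, ∀ p ∈ K, ∀ q ∈ K, |B p.1 p.2 - B q.1 q.2| ≤ C * dist p q ^ ϑ

/-- Hypothesis (init): `u0 ∈ C⁰(Ω̄)` nonnegative, `v0 ∈ W^{1,∞}(Ω)` (i.e. Lipschitz)
positive on `Ω̄`. -/
def HypInit (a b : ℝ) (u0 v0 : ℝ → ℝ) : Prop :=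
  ContinuousOn u0 (Set.Icc a b) ∧ (∀ x ∈ Set.Icc a b, 0 ≤ u0 x) ∧
  (∃ L : ℝ≥0, LipschitzOnWith L v0 (Set.Icc a b)) ∧ (∀ x ∈ Set.Icc a b, 0 < v0 x)

/-- Hypothesis (H1): `∫_0^∞ ∫_Ω B1 < ∞`. -/
def HypH1 (a b : ℝ) (B1 : ℝ → ℝ → ℝ) : Prop :=
  MeasureTheory.IntegrableOn (fun p : ℝ × ℝ => B1 p.1 p.2)
    ((Set.Ioo a b) ×ˢ (Set.Ioi (0:ℝ)))

/-- Hypothesis (H1'): `∫_t^{t+1} ∫_Ω B1 → 0` as `t → ∞`. -/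
def HypH1' (a b : ℝ) (B1 : ℝ → ℝ → ℝ) : Prop :=
  Filter.Tendsto (fun t : ℝ => ∫ s in t..(t+1), ∫ x in Set.Ioo a b, B1 x s)
    Filter.atTop (nhds 0)

/-- Hypothesis (H2): `inf_{t>0} ∫_Ω B2(·,t) > 0`. -/
def HypH2 (a b : ℝ) (B2 : ℝ → ℝ → ℝ) : Prop :=
  ∃ c : ℝ, 0 < c ∧ ∀ t : ℝ, 0 < t → c ≤ ∫ x in Set.Ioo a b, B2 x t

/-- Hypothesis (H3): `B2(·,t)` stabilizes to `B2inf ∈ L²(Ω)` in the averaged `L²` sense. -/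
def HypH3 (a b : ℝ) (B2 : ℝ → ℝ → ℝ) (B2inf : ℝ → ℝ) : Prop :=
  MeasureTheory.MemLp B2inf 2 (MeasureTheory.volume.restrict (Set.Ioo a b)) ∧
  Filter.Tendsto
    (fun t : ℝ => ∫ s in t..(t+1), ∫ x in Set.Ioo a b, (B2 x s - B2inf x)^2)
    Filter.atTop (nhds 0)

/-- A classical solution of the urban crime system
`u_t = u_xx − χ (u/v · v_x)_x − uv + B1`, `v_t = v_xx + uv − v + B2` on
`Ω̄ × [0, Tmax)`, `Ω = (a,b)`, with homogeneous Neumann boundary conditions and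
initial data `(u0, v0)`; `u, v` are positive on `Ω̄ × (0, Tmax)`, belong to
`C⁰(Ω̄ × [0,Tmax)) ∩ C^{2,1}(Ω̄ × (0,Tmax))` and `v(·,t)` lies in `W^{1,r}(Ω)`,
continuously in `t`, for every `r > 1`. -/
structure CrimeSol (a b χ : ℝ) (B1 B2 : ℝ → ℝ → ℝ) (u0 v0 : ℝ → ℝ)
    (u v : ℝ → ℝ → ℝ) (Tmax : ℝ≥0∞) : Prop where
  u_cont : ContinuousOn (fun p : ℝ × ℝ => u p.1 p.2) ((Set.Icc a b) ×ˢ It Tmax)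
  v_cont : ContinuousOn (fun p : ℝ × ℝ => v p.1 p.2) ((Set.Icc a b) ×ˢ It Tmax)
  u_init : ∀ x ∈ Set.Icc a b, u x 0 = u0 x
  v_init : ∀ x ∈ Set.Icc a b, v x 0 = v0 x
  u_pos : ∀ x ∈ Set.Icc a b, ∀ t ∈ It' Tmax, 0 < u x t
  v_pos : ∀ x ∈ Set.Icc a b, ∀ t ∈ It' Tmax, 0 < v x t
  u_reg : ∀ x ∈ Set.Icc a b, ∀ t ∈ It' Tmax,
    DifferentiableAt ℝ (fun y => u y t) x ∧
    DifferentiableAt ℝ (fun y => pdx u y t) x ∧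
    DifferentiableAt ℝ (fun s => u x s) t
  v_reg : ∀ x ∈ Set.Icc a b, ∀ t ∈ It' Tmax,
    DifferentiableAt ℝ (fun y => v y t) x ∧
    DifferentiableAt ℝ (fun y => pdx v y t) x ∧
    DifferentiableAt ℝ (fun s => v x s) t
  u_cont21 : ContinuousOn
    (fun p : ℝ × ℝ => (pdx u p.1 p.2, pdx (pdx u) p.1 p.2, pdt u p.1 p.2))
    ((Set.Icc a b) ×ˢ It' Tmax)
  v_cont21 : ContinuousOn
    (fun p : ℝ × ℝ => (pdx v p.1 p.2, pdx (pdx v) p.1 p.2, pdt v p.1 p.2))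
    ((Set.Icc a b) ×ˢ It' Tmax)
  v_W1r : ∀ r : ℝ, 1 < r →
    (∀ t ∈ It Tmax,
      MeasureTheory.IntegrableOn (fun x => |pdx v x t| ^ r) (Set.Ioo a b)) ∧
    ContinuousOn (fun t => ∫ x in Set.Ioo a b, |pdx v x t| ^ r) (It Tmax)
  u_eq : ∀ x ∈ Set.Ioo a b, ∀ t ∈ It' Tmax,
    pdt u x t = pdx (pdx u) x t
      - χ * pdx (fun y s => u y s / v y s * pdx v y s) x t
      - u x t * v x t + B1 x t
  v_eq : ∀ x ∈ Set.Ioo a b, ∀ t ∈ It' Tmax,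
    pdt v x t = pdx (pdx v) x t + u x t * v x t - v x t + B2 x t
  u_bc : ∀ t ∈ It' Tmax, pdx u a t = 0 ∧ pdx u b t = 0
  v_bc : ∀ t ∈ It' Tmax, pdx v a t = 0 ∧ pdx v b t = 0

/-- A classical solution of the stationary Neumann problem
`−w'' + w = B` in `Ω = (a,b)`, `w' = 0` on `∂Ω`. -/
def IsStationarySol (a b : ℝ) (B : ℝ → ℝ) (w : ℝ → ℝ) : Prop :=
  ContinuousOn w (Set.Icc a b) ∧
  (∀ x ∈ Set.Icc a b, DifferentiableAt ℝ w x ∧ DifferentiableAt ℝ (deriv w) x) ∧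
  (∀ x ∈ Set.Ioo a b, -(deriv (deriv w) x) + w x = B x) ∧
  deriv w a = 0 ∧ deriv w b = 0

/-- The branches `q^±(p) = (1−p)/2 · (1 ∓/± √(1 − pχ²))`. -/
def qminus (χ p : ℝ) : ℝ := (1 - p) / 2 * (1 - Real.sqrt (1 - p * χ^2))

def qplus (χ p : ℝ) : ℝ := (1 - p) / 2 * (1 + Real.sqrt (1 - p * χ^2))

/-- The auxiliary functions `φ₁, φ₂, φ₃` and the constant `p₀`. -/
def phi1 (p : ℝ) : ℝ := (p + 1) / (1 - p)

def phi2 (χ p : ℝ) : ℝ := (1 - p) / (2 * p) * (1 + Real.sqrt (1 - p * χ^2))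

def phi3 (χ p : ℝ) : ℝ := (1 - p) / (2 * p) * (1 - Real.sqrt (1 - p * χ^2))

def p0 : ℝ := (2 * Real.sqrt 3 - 3) / 3

/-- Auxiliary function: `φ₁ s ≤ φ₂` is equivalent to `0 ≤ GG`. -/
def GG (χ s p : ℝ) : ℝ := (1 - p)^2 * (1 + Real.sqrt (1 - p * χ^2)) - 2 * p * (1 + p) * s

lemma GG_cont (χ s : ℝ) : Continuous (GG χ s) := by
  unfold GG; fun_prop

lemma p0_facts : 0 < p0 ∧ p0 < 1/5 ∧ 3 * p0^2 + 6 * p0 - 1 = 0 := by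
  have h3 : Real.sqrt 3 ^ 2 = 3 := Real.sq_sqrt (by norm_num)
  have h0 := Real.sqrt_nonneg 3
  unfold p0
  refine ⟨?_, ?_, ?_⟩ <;> nlinarith

lemma phi_iff (χ s p : ℝ) (h0 : 0 < p) (h1 : p < 1) :
    phi1 p * s ≤ phi2 χ p ↔ 0 ≤ GG χ s p := by
  have h2 : 0 < 1 - p := by linarith
  unfold phi1 phi2 GG
  rw [div_mul_eq_mul_div, div_mul_eq_mul_div, div_le_div_iff₀ h2 (by linarith)]
  constructor <;> intro h <;> nlinarith

lemma chi_fact (χ : ℝ) (hχ : 0 < χ) (hχ' : χ < Real.sqrt (6 * Real.sqrt 3 + 9) / 2) :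
    p0 * χ^2 < 3/4 := by
  have h3 : Real.sqrt 3 ^ 2 = 3 := Real.sq_sqrt (by norm_num)
  have h0 := Real.sqrt_nonneg 3
  have h4 : Real.sqrt (6 * Real.sqrt 3 + 9) ^ 2 = 6 * Real.sqrt 3 + 9 :=
    Real.sq_sqrt (by linarith)
  have h5 : χ^2 < (6 * Real.sqrt 3 + 9) / 4 := by nlinarith
  have h6 := p0_facts.1
  have h7 : p0 * χ^2 < p0 * ((6 * Real.sqrt 3 + 9) / 4) := mul_lt_mul_of_pos_left h5 h6
  have h8 : p0 * ((6 * Real.sqrt 3 + 9) / 4) = 3/4 := by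
    unfold p0; nlinarith
  linarith

lemma sqrt_fact (χ p : ℝ) (h : p0 * χ^2 < 3/4) (hp : p ≤ p0) :
    1/2 < Real.sqrt (1 - p * χ^2) := by
  apply Real.lt_sqrt_of_sq_lt
  nlinarith [sq_nonneg χ]

lemma S_nonempty (χ s : ℝ) (hs : 1 ≤ s) :
    ∃ p ∈ Set.Ioo (0:ℝ) p0, phi1 p * s ≤ phi2 χ p := by
  obtain ⟨a, b, -⟩ := p0_facts
  have hs0 : 0 < s := by linarith
  have e : p0 / (2 * s) * (2 * s) = p0 := by field_simp
  have q0 : 0 < p0 / (2 * s) := by positivity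
  have q1 : p0 / (2 * s) ≤ p0 / 2 := by
    apply div_le_div_of_nonneg_left a.le <;> linarith
  generalize p0 / (2 * s) = q at *
  refine ⟨q, ⟨q0, by linarith⟩, ?_⟩
  rw [phi_iff _ _ _ q0 (by linarith)]
  unfold GG
  have := Real.sqrt_nonneg (1 - q * χ^2)
  have h2 : 0 ≤ (1 - q)^2 * Real.sqrt (1 - q * χ^2) := by positivity
  have h3 : 2 * q * (1 + q) * s = p0 * (1 + q) := by rw [← e]; ring
  nlinarith

lemma S_sup (χ s : ℝ) (hs : 1 ≤ s) (T : Set ℝ)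
    (hT : T = {p : ℝ | p ∈ Set.Ioo (0:ℝ) p0 ∧ phi1 p * s ≤ phi2 χ p}) :
    BddAbove T ∧ 0 < sSup T ∧ sSup T ≤ p0 ∧ 0 ≤ GG χ s (sSup T) ∧
      (sSup T < p0 → GG χ s (sSup T) ≤ 0) := by
  obtain ⟨a, b, -⟩ := p0_facts
  obtain ⟨q, hq, hq'⟩ := S_nonempty χ s hs
  have hqT : q ∈ T := by rw [hT]; exact ⟨hq, hq'⟩
  have hub : ∀ x ∈ T, x ≤ p0 := by
    intro x hx; rw [hT] at hx; exact hx.1.2.le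
  have hb : BddAbove T := ⟨p0, hub⟩
  have hqP : q ≤ sSup T := le_csSup hb hqT
  refine ⟨hb, lt_of_lt_of_le hq.1 hqP, csSup_le ⟨q, hqT⟩ hub, ?_, ?_⟩
  · have hcl : IsClosed {x | 0 ≤ GG χ s x} := isClosed_le continuous_const (GG_cont χ s)
    have hsub : T ⊆ {x | 0 ≤ GG χ s x} := by
      intro x hx; rw [hT] at hx
      exact (phi_iff _ _ _ hx.1.1 (by linarith [hx.1.2])).1 hx.2
    exact closure_minimal hsub hcl (csSup_mem_closure ⟨q, hqT⟩ hb)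
  · intro hlt
    by_contra! hG
    have e1 : ∀ᶠ x in 𝓝 (sSup T), 0 < GG χ s x :=
      (GG_cont χ s).continuousAt.eventually (lt_mem_nhds hG)
    have e2 : ∀ᶠ x in 𝓝 (sSup T), x < p0 := gt_mem_nhds hlt
    have e3 : ∀ᶠ x in 𝓝[>] (sSup T), (0 < GG χ s x ∧ x < p0) ∧ sSup T < x :=
      ((e1.and e2).filter_mono nhdsWithin_le_nhds).and self_mem_nhdsWithin
    obtain ⟨x, ⟨hx1, hx2⟩, hx3⟩ := e3.exists
    have hx0 : 0 < x := by linarith [hq.1]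
    have : x ∈ T := by
      rw [hT]
      exact ⟨⟨hx0, hx2⟩, (phi_iff _ _ _ hx0 (by linarith)).2 hx1.le⟩
    linarith [le_csSup hb this]

lemma phi1_mono {x y : ℝ} (hxy : x ≤ y) (hy : y < 1) : phi1 x ≤ phi1 y := by
  unfold phi1
  rw [div_le_div_iff₀ (by linarith) (by linarith)]
  nlinarith

lemma one_lt_phi1 {x : ℝ} (h0 : 0 < x) (h1 : x < 1) : 1 < phi1 x := by
  unfold phi1
  rw [lt_div_iff₀ (by linarith)]
  linarith

/-- Lemma 5.2 (the recursively defined sequences `(p_k)` and `(r_k)`). -/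
theorem recursive_exponent_sequences
    (χ : ℝ) (hχ : 0 < χ) (hχ' : χ < Real.sqrt (6 * Real.sqrt 3 + 9) / 2)
    (S : ℝ → Set ℝ)
    (hS : ∀ s : ℝ, S s = {p : ℝ | p ∈ Set.Ioo (0:ℝ) p0 ∧ phi1 p * s ≤ phi2 χ p})
    (p r : ℕ → ℝ) (hr0 : r 0 = 1)
    (hp : ∀ k : ℕ, p (k+1) = sSup (S (r k)))
    (hr : ∀ k : ℕ, r (k+1) = phi1 (p (k+1)) * r k) :
    (∀ s : ℝ, 1 ≤ s → (S s).Nonempty) ∧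
    (∀ k : ℕ, p (k+1) ∈ Set.Ioc (0:ℝ) p0) ∧
    (∀ k : ℕ, 1 < r (k+1)) ∧
    (∀ k : ℕ, p (k+2) ≤ p (k+1)) ∧
    (∀ k : ℕ, r k < r (k+1)) ∧
    Filter.Tendsto r Filter.atTop Filter.atTop ∧
    (∀ k : ℕ, qminus χ (p (k+1)) < p (k+1) * r (k+1) ∧
      p (k+1) * r (k+1) ≤ qplus χ (p (k+1))) ∧
    (∀ k : ℕ, p (k+1) * r (k+1) ≤
      p (k+1) * (p (k+1) + 1) / (1 - p (k+1)) * r k) := by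
  obtain ⟨a, b, c⟩ := p0_facts
  have hc := chi_fact χ hχ hχ'
  have hne : ∀ s : ℝ, 1 ≤ s → (S s).Nonempty := by
    intro s hs
    obtain ⟨q, h1, h2⟩ := S_nonempty χ s hs
    exact ⟨q, by rw [hS]; exact ⟨h1, h2⟩⟩
  have step : ∀ k, 1 ≤ r k → 0 < p (k+1) ∧ p (k+1) ≤ p0 ∧ r k < r (k+1) := by
    intro k hk
    obtain ⟨-, h1, h2, -, -⟩ := S_sup χ (r k) hk _ (hS _)
    rw [← hp] at h1 h2
    refine ⟨h1, h2, ?_⟩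
    rw [hr]
    have := one_lt_phi1 h1 (by linarith)
    nlinarith
  have r1 : ∀ k, 1 ≤ r k := by
    intro k
    induction k with
    | zero => rw [hr0]
    | succ k ih => linarith [(step k ih).2.2]
  have p_pos : ∀ k, 0 < p (k+1) := fun k => (step k (r1 k)).1
  have p_le : ∀ k, p (k+1) ≤ p0 := fun k => (step k (r1 k)).2.1
  have r_lt : ∀ k, r k < r (k+1) := fun k => (step k (r1 k)).2.2
  have key : ∀ k, (1 - p (k+1)) * r (k+1) = (p (k+1) + 1) * r k := by
    intro k
    have : 1 - p (k+1) ≠ 0 := by linarith [p_le k]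
    rw [hr, phi1]
    field_simp
  refine ⟨hne, fun k => ⟨p_pos k, p_le k⟩, fun k => lt_of_le_of_lt (r1 k) (r_lt k), ?_, r_lt,
    ?_, ?_, ?_⟩
  · intro k
    rw [hp (k+1), hp k]
    apply csSup_le_csSup (S_sup χ (r k) (r1 k) _ (hS _)).1 (hne _ (r1 _))
    intro x hx
    rw [hS] at hx ⊢
    refine ⟨hx.1, le_trans ?_ hx.2⟩
    have h1 := one_lt_phi1 hx.1.1 (by linarith [hx.1.2])
    exact mul_le_mul_of_nonneg_left (r_lt k).le (by linarith)
  · apply tendsto_atTop_atTop_of_monotone (monotone_nat_of_le_succ fun k => (r_lt k).le)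
    intro M
    by_contra! hM
    have hM1 : 1 ≤ M := by linarith [hM 0]
    obtain ⟨q, hq⟩ := hne M hM1
    have hq' := hq
    rw [hS] at hq'
    obtain ⟨⟨q0, q1⟩, hq2⟩ := hq'
    have hphi := one_lt_phi1 q0 (by linarith)
    have hpk : ∀ k, q ≤ p (k+1) := by
      intro k
      rw [hp k]
      apply le_csSup (S_sup χ (r k) (r1 k) _ (hS _)).1
      rw [hS]
      refine ⟨⟨q0, q1⟩, le_trans ?_ hq2⟩
      exact mul_le_mul_of_nonneg_left (hM k).le (by linarith)
    have hpow : ∀ k, phi1 q ^ k ≤ r k := by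
      intro k
      induction k with
      | zero => simp [hr0]
      | succ k ih =>
        rw [hr, pow_succ, mul_comm]
        have := phi1_mono (hpk k) (by linarith [p_le k])
        have := r1 k
        exact mul_le_mul ‹_› ih (by positivity) (by linarith)
    obtain ⟨n, hn⟩ := pow_unbounded_of_one_lt M hphi
    linarith [hpow n, hM n]
  · intro k
    obtain ⟨-, -, -, h1, h2⟩ := S_sup χ (r k) (r1 k) _ (hS _)
    rw [← hp] at h1 h2
    have hk := key k
    have hs := sqrt_fact χ (p (k+1)) hc (p_le k)
    have g : GG χ (r k) (p (k+1)) = 2 * (1 - p (k+1)) *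
        (qplus χ (p (k+1)) - p (k+1) * r (k+1)) := by
      unfold GG qplus
      linear_combination (2 * p (k+1)) * hk
    have hpl := p_le k
    have hpp := p_pos k
    have h1p : 0 < 2 * (1 - p (k+1)) := by linarith
    constructor
    · rcases hpl.lt_or_eq with hlt | heq
      · have h3 := h2 hlt
        rw [g] at h3
        have h4 : qplus χ (p (k+1)) - p (k+1) * r (k+1) ≤ 0 := by
          by_contra! h
          linarith [mul_pos h1p h]
        have : qminus χ (p (k+1)) < qplus χ (p (k+1)) := by
          unfold qminus qplus
          apply mul_lt_mul_of_pos_left <;> linarith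
        linarith
      · rw [heq] at hk hs ⊢
        have hq : qminus χ p0 < (1 - p0) / 4 := by
          unfold qminus
          nlinarith
        have h5 : (1 - p0) / 4 * (1 - p0) ≤ p0 * r (k+1) * (1 - p0) := by
          have : p0 * r (k+1) * (1 - p0) = p0 * (p0 + 1) * r k := by
            linear_combination p0 * hk
          rw [this]
          have : p0 * (p0+1) * 1 ≤ p0 * (p0+1) * r k :=
            mul_le_mul_of_nonneg_left (r1 k) (by positivity)
          nlinarith
        have := le_of_mul_le_mul_right h5 (by linarith)
        linarith
    · rw [g] at h1
      have := nonneg_of_mul_nonneg_right h1 h1p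
      linarith
  · intro k
    rw [hr, phi1]
    apply le_of_eq
    ring
end
end

section
/- Let T ∈ (0, ∞] and τ ∈ (0, T), and let y ∈ C¹([0,T)) and h ∈ L¹_loc([0,∞)) be nonnegative functions such that, for some a > 0 and b > 0, y'(t) + a·y(t) ≤ h(t) for all t ∈ (0,T) and (1/τ) ∫_t^{t+τ} h(s) ds ≤ b for all t ∈ (0,T). Then y(t) ≤ y(0) + bτ/(1 − e^{−aτ}) for all t ∈ [0,T). -/
open Real MeasureTheory Filter Topology Set
open scoped ENNReal NNReal

noncomputable section

/-- Lemma A.1 (ODE lemma: boundedness from an averaged bound on the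
inhomogeneity). -/
theorem ode_lemma_boundedness
    (T : ℝ≥0∞) (hT : 0 < T) (τ : ℝ) (hτ : 0 < τ) (hτT : ENNReal.ofReal τ < T)
    (y y' h : ℝ → ℝ) (a b : ℝ) (ha : 0 < a) (hb : 0 < b)
    (hy : ∀ t ∈ It T, HasDerivAt y (y' t) t)
    (hy' : ContinuousOn y' (It T))
    (hynn : ∀ t ∈ It T, 0 ≤ y t)
    (hhnn : ∀ t : ℝ, 0 ≤ t → 0 ≤ h t)
    (hhloc : MeasureTheory.LocallyIntegrableOn h (Set.Ici 0))
    (hode : ∀ t ∈ It' T, y' t + a * y t ≤ h t)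
    (havg : ∀ t ∈ It' T, (1/τ) * ∫ s in t..(t+τ), h s ≤ b) :
    ∀ t ∈ It T, y t ≤ y 0 + b * τ / (1 - Real.exp (-a * τ)) := by
  have hdown : ∀ s t : ℝ, s ≤ t → ENNReal.ofReal t < T → ENNReal.ofReal s < T :=
    fun s t hst ht => lt_of_le_of_lt (ENNReal.ofReal_le_ofReal hst) ht
  have hint : ∀ s t : ℝ, 0 ≤ s → IntegrableOn h (Set.Icc s t) := fun s t hs =>
    hhloc.integrableOn_compact_subset (fun r hr => hs.trans hr.1) isCompact_Icc
  have hbτ : ∀ s t : ℝ, 0 < s → s ≤ t → t ≤ s + τ → ENNReal.ofReal t < T →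
      ∫ r in s..t, h r ≤ b * τ := by
    intro s t hs hst hts ht
    have h1 := havg s ⟨hs, hdown s t hst ht⟩
    rw [one_div, inv_mul_le_iff₀ hτ] at h1
    have h2 : ∫ r in s..t, h r ≤ ∫ r in s..(s+τ), h r := by
      rw [intervalIntegral.integral_of_le hst, intervalIntegral.integral_of_le (hst.trans hts)]
      refine setIntegral_mono_set ((hint s (s+τ) hs.le).mono_set Ioc_subset_Icc_self) ?_ ?_
      · exact (ae_restrict_mem measurableSet_Ioc).mono
          (fun r hr => hhnn r (hs.le.trans hr.1.le))
      · exact (Ioc_subset_Ioc_right hts).eventuallyLE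
    linarith [mul_comm τ b]
  have key : ∀ s t : ℝ, 0 < s → s ≤ t → t ≤ s + τ → ENNReal.ofReal t < T →
      y t ≤ Real.exp (a * (s - t)) * y s + b * τ := by
    intro s t hs hst hts ht
    have hd : ∀ r ∈ Set.Icc s t, HasDerivAt (fun r => Real.exp (a * (r - t)) * y r)
        (Real.exp (a * (r - t)) * (a * 1) * y r + Real.exp (a * (r - t)) * y' r) r := by
      intro r hr
      exact ((((hasDerivAt_id' r).sub_const t).const_mul a).exp).mul
        (hy r ⟨hs.le.trans hr.1, hdown r t hr.2 ht⟩)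
    have h1 := intervalIntegral.sub_le_integral_of_hasDeriv_right_of_le hst
      (fun r hr => (hd r hr).continuousAt.continuousWithinAt)
      (fun r hr => (hd r (Ioo_subset_Icc_self hr)).hasDerivWithinAt)
      (hint s t hs.le) (by
        intro r hr
        have hr0 : 0 < r := hs.trans hr.1
        have h2 := hode r ⟨hr0, hdown r t hr.2.le ht⟩
        have h3 : Real.exp (a * (r - t)) ≤ 1 := by
          rw [Real.exp_le_one_iff]; nlinarith [hr.2]
        have h4 := Real.exp_pos (a * (r - t))
        have h5 := hhnn r hr0.le
        nlinarith [mul_le_mul_of_nonneg_left h2 h4.le, mul_le_mul_of_nonneg_right h3 h5])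
    simp only [sub_self, mul_zero, Real.exp_zero, one_mul] at h1
    linarith [hbτ s t hs hst hts ht]
  have hq1 : Real.exp (-a * τ) < 1 := by
    rw [Real.exp_lt_one_iff]; nlinarith
  have hq0 := Real.exp_pos (-a * τ)
  set q := Real.exp (-a * τ) with hq
  have h1q : 0 < 1 - q := by linarith
  set C := b * τ / (1 - q) with hC
  have hCeq : C * (1 - q) = b * τ := div_mul_cancel₀ _ h1q.ne'
  have hbτ0 : 0 < b * τ := mul_pos hb hτ
  have hC0 : 0 < C := div_pos hbτ0 h1q
  have hy00 : 0 ≤ y 0 := hynn 0 ⟨le_rfl, by simpa using hT⟩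
  have claim : ∀ n : ℕ, ∀ t ∈ It T, t ≤ (n + 1 : ℝ) * τ → y t ≤ y 0 + C := by
    have small : ∀ t ∈ It T, t ≤ τ → y t ≤ y 0 + C := by
      intro t ht htτ
      rcases ht.1.eq_or_lt with h0 | h0
      · rw [← h0]; linarith
      have hlim : Tendsto (fun s => y s + b * τ) (𝓝[>] 0) (𝓝 (y 0 + b * τ)) :=
        ((hy 0 ⟨le_rfl, by simpa using hT⟩).continuousAt.tendsto.mono_left
          nhdsWithin_le_nhds).add_const _
      have : y t ≤ y 0 + b * τ := by
        refine ge_of_tendsto hlim ?_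
        filter_upwards [Ioo_mem_nhdsGT h0] with s hs
        have h1 := key s t hs.1 hs.2.le (by linarith [hs.1]) ht.2
        have h3 : Real.exp (a * (s - t)) ≤ 1 := by
          rw [Real.exp_le_one_iff]; nlinarith [hs.2]
        nlinarith [hynn s ⟨hs.1.le, hdown s t hs.2.le ht.2⟩]
      nlinarith
    intro n
    induction n with
    | zero => intro t ht h1; exact small t ht (by simpa using h1)
    | succ n ih =>
      intro t ht h1
      rcases le_or_gt t τ with h2 | h2
      · exact small t ht h2
      have h3 := key (t - τ) t (by linarith) (by linarith) (by linarith) ht.2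
      have h4 := ih (t - τ) ⟨by linarith, hdown _ t (by linarith) ht.2⟩ (by
        push_cast at h1; linarith)
      have h5 : a * (t - τ - t) = -a * τ := by ring
      rw [h5, ← hq] at h3
      nlinarith [mul_le_mul_of_nonneg_left h4 hq0.le]
  intro t ht
  obtain ⟨n, hn⟩ := exists_nat_ge (t / τ)
  refine claim n t ht ?_
  rw [div_le_iff₀ hτ] at hn
  linarith
end
end

section
/- Let y ∈ C¹([0,∞)) and h ∈ L¹_loc([0,∞)) be nonnegative functions satisfying y'(t) + a·y(t) ≤ h(t) for all t > 0, with some a > 0. If ∫_t^{t+1} h(s) ds → 0 as t → ∞, then y(t) → 0 as t → ∞. -/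
open Real MeasureTheory Filter Topology Set
open scoped ENNReal NNReal

noncomputable section

/-- One-step estimate for the differential inequality. -/
theorem ode_step
    (y y' h : ℝ → ℝ) (a : ℝ) (ha : 0 < a)
    (hy : ∀ t : ℝ, 0 ≤ t → HasDerivAt y (y' t) t)
    (hhnn : ∀ t : ℝ, 0 ≤ t → 0 ≤ h t)
    (hhloc : MeasureTheory.LocallyIntegrableOn h (Set.Ici 0))
    (hode : ∀ t : ℝ, 0 < t → y' t + a * y t ≤ h t)
    (t r : ℝ) (ht : 0 ≤ t) (hr : 0 ≤ r) (hr1 : r ≤ 1) :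
    y (t + r) ≤ Real.exp (-(a * r)) * y t + ∫ s in t..(t+1), h s := by
  have hint : ∀ c d : ℝ, 0 ≤ c → MeasureTheory.IntegrableOn h (Set.Icc c d) := by
    intro c d hc
    exact hhloc.integrableOn_compact_subset
      (fun x hx => le_trans hc hx.1) isCompact_Icc
  have hd : ∀ s : ℝ, 0 ≤ s → HasDerivAt (fun s => Real.exp (a * (s - (t + r))) * y s)
      (Real.exp (a * (s - (t + r))) * (y' s + a * y s)) s := by
    intro s hs
    have h1 : HasDerivAt (fun s : ℝ => a * (s - (t + r))) (a * 1) s :=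
      ((hasDerivAt_id s).sub_const (t + r)).const_mul a
    have h2 := h1.exp.mul (hy s hs)
    exact h2.congr_deriv (by ring)
  have key := intervalIntegral.sub_le_integral_of_hasDeriv_right_of_le
    (g := fun s => Real.exp (a * (s - (t + r))) * y s)
    (g' := fun s => Real.exp (a * (s - (t + r))) * (y' s + a * y s))
    (φ := h) (a := t) (b := t + r) (by linarith)
    (fun s hs => (hd s (le_trans ht hs.1)).continuousAt.continuousWithinAt)
    (fun s hs => (hd s (le_trans ht hs.1.le)).hasDerivWithinAt)
    (hint _ _ ht)
    (by
      intro s hs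
      have hs0 : 0 < s := lt_of_le_of_lt ht hs.1
      have he : Real.exp (a * (s - (t + r))) ≤ 1 := by
        rw [Real.exp_le_one_iff]
        have := hs.2
        nlinarith
      calc Real.exp (a * (s - (t + r))) * (y' s + a * y s)
          ≤ Real.exp (a * (s - (t + r))) * h s :=
            mul_le_mul_of_nonneg_left (hode s hs0) (Real.exp_pos _).le
        _ ≤ 1 * h s := mul_le_mul_of_nonneg_right he (hhnn s hs0.le)
        _ = h s := one_mul _)
  have hmono : ∫ s in t..(t+r), h s ≤ ∫ s in t..(t+1), h s := by
    rw [intervalIntegral.integral_of_le (by linarith), intervalIntegral.integral_of_le (by linarith)]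
    apply MeasureTheory.setIntegral_mono_set
    · exact (hint t (t+1) ht).mono_set Set.Ioc_subset_Icc_self
    · refine (MeasureTheory.ae_restrict_iff' measurableSet_Ioc).2 (Eventually.of_forall ?_)
      intro x hx
      exact hhnn x (le_trans ht hx.1.le)
    · exact (Set.Ioc_subset_Ioc_right (by linarith)).eventuallyLE
  have e1 : a * (t - (t + r)) = -(a * r) := by ring
  simp only [sub_self, mul_zero, Real.exp_zero, one_mul, e1] at key
  linarith

/-- Lemma A.2 (ODE lemma: decay from an averaged decay of the inhomogeneity). -/
theorem ode_lemma_decay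
    (y y' h : ℝ → ℝ) (a : ℝ) (ha : 0 < a)
    (hy : ∀ t : ℝ, 0 ≤ t → HasDerivAt y (y' t) t)
    (hy' : ContinuousOn y' (Set.Ici 0))
    (hynn : ∀ t : ℝ, 0 ≤ t → 0 ≤ y t)
    (hhnn : ∀ t : ℝ, 0 ≤ t → 0 ≤ h t)
    (hhloc : MeasureTheory.LocallyIntegrableOn h (Set.Ici 0))
    (hode : ∀ t : ℝ, 0 < t → y' t + a * y t ≤ h t)
    (hdecay : Filter.Tendsto (fun t : ℝ => ∫ s in t..(t+1), h s)
      Filter.atTop (nhds 0)) :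
    Filter.Tendsto y Filter.atTop (nhds 0) := by
  have step := ode_step y y' h a ha hy hhnn hhloc hode
  set q := Real.exp (-a) with hq
  have hq0 : 0 < q := Real.exp_pos _
  have hq1 : q < 1 := by rw [hq, Real.exp_lt_one_iff]; linarith
  have h1q : 0 < 1 - q := by linarith
  rw [Metric.tendsto_atTop]
  intro δ hδ
  set K := 1 / (1 - q) + 1 with hK
  have hK0 : 0 < K := by positivity
  set ε := δ / (2 * K) with hε
  have hε0 : 0 < ε := by positivity
  obtain ⟨T₀, hT₀⟩ := (Metric.tendsto_atTop.1 hdecay) ε hε0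
  set T := max T₀ 0 with hT
  have hT0 : 0 ≤ T := le_max_right _ _
  have hI : ∀ t, T ≤ t → ∫ s in t..(t+1), h s ≤ ε := by
    intro t ht
    have := hT₀ t (le_trans (le_max_left _ _) ht)
    rw [Real.dist_eq, sub_zero] at this
    exact (lt_of_le_of_lt (le_abs_self _) this).le
  have hn : ∀ n : ℕ, y (T + n) ≤ q ^ n * y T + ε * (1 / (1 - q)) := by
    intro n
    induction n with
    | zero =>
      have : 0 ≤ ε * (1 / (1 - q)) := by positivity
      simpa using this
    | succ n ih =>
      have hn0 : (0:ℝ) ≤ n := Nat.cast_nonneg n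
      have h1 := step (T + n) 1 (by linarith) zero_le_one le_rfl
      rw [mul_one, ← hq] at h1
      have h2 := hI (T + n) (by linarith)
      have h3 := mul_le_mul_of_nonneg_left ih hq0.le
      have h4 : ε * (1 / (1 - q)) = q * (ε * (1 / (1 - q))) + ε := by
        field_simp
        ring
      have h5 : T + ((n + 1 : ℕ) : ℝ) = T + n + 1 := by push_cast; ring
      rw [h5, pow_succ]
      nlinarith
  have hlim : Tendsto (fun n : ℕ => q ^ n * y T) atTop (𝓝 0) := by
    simpa using (tendsto_pow_atTop_nhds_zero_of_lt_one hq0.le hq1).mul_const (y T)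
  obtain ⟨N, hN⟩ := (Metric.tendsto_atTop.1 hlim) (δ / 2) (by positivity)
  refine ⟨T + N, fun t ht => ?_⟩
  have hN0 : (0:ℝ) ≤ N := Nat.cast_nonneg N
  have htT : 0 ≤ t - T := by linarith
  set n := ⌊t - T⌋₊ with hndef
  have hnN : N ≤ n := Nat.le_floor (by linarith)
  have hn1 : (n:ℝ) ≤ t - T := Nat.floor_le htT
  have hn2 : t - T < n + 1 := Nat.lt_floor_add_one _
  have hn0 : (0:ℝ) ≤ n := Nat.cast_nonneg n
  have h1 := step (T + n) (t - T - n) (by linarith) (by linarith) (by linarith)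
  rw [show T + n + (t - T - n) = t by ring] at h1
  have h2 := hI (T + n) (by linarith)
  have h3 : Real.exp (-(a * (t - T - n))) ≤ 1 := by
    rw [Real.exp_le_one_iff]
    have : 0 ≤ a * (t - T - n) := mul_nonneg ha.le (by linarith)
    linarith
  have h4 := mul_le_mul_of_nonneg_right h3 (hynn (T + n) (by linarith))
  have h5 := hn n
  have h6 := hN n hnN
  rw [Real.dist_eq, sub_zero] at h6
  have h7 := lt_of_le_of_lt (le_abs_self _) h6
  have h8 : ε * (1 / (1 - q)) + ε = δ / 2 := by
    have : ε * K = δ / 2 := by rw [hε]; field_simp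
    rw [← this, hK]; ring
  rw [Real.dist_eq, sub_zero, abs_of_nonneg (hynn t (by linarith))]
  linarith
end
end
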